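/- Let E be a non-trivial regular equational theory and Γ = { s ≈_E^? t } an E-unification problem such that Var(s) ∩ Var(t) = ∅. Then the set C_E(Γ), consisting of all E-unifiers σ of Γ such that for every y ∈ VRan(σ) there exist variables x ≠ x' with y ∈ Var(σ(x)) ∩ Var(σ(x')), is a complete set of E-unifiers of Γ w.r.t. the unrestricted instantiation preorder ≤_E^V. -/

import Mathlib

namespace UnifFW

/-- First-order terms over a signature `F` (an arity-indexed family of function
symbols), with variables from the countably infinite set `V = ℕ`. -/
inductive Term (F : ℕ → Type) : Type
  | var : ℕ → Term F
  | app : (n : ℕ) → F n → (Fin n → Term F) → Term F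

variable {F : ℕ → Type}

/-- The set of variables occurring in a term. -/
def Term.vars : Term F → Set ℕ
  | .var x => {x}
  | .app _ _ ts => ⋃ i, (ts i).vars

/-- Homomorphic extension of a map `V → T(Σ,V)` to terms. -/
def Term.subst (σ : ℕ → Term F) : Term F → Term F
  | .var x => σ x
  | .app n f ts => .app n f (fun i => (ts i).subst σ)

/-- The congruence `≈_E` induced by a set `E` of identities: the smallest
equivalence relation containing all substitution instances of identities of `E`
and compatible with the term constructors. -/
inductive EqE (E : Set (Term F × Term F)) : Term F → Term F → Prop
  | ax {s t : Term F} (σ : ℕ → Term F) : (s, t) ∈ E → EqE E (s.subst σ) (t.subst σ)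
  | refl (t : Term F) : EqE E t t
  | symm {s t : Term F} : EqE E s t → EqE E t s
  | trans {s t u : Term F} : EqE E s t → EqE E t u → EqE E s u
  | congr {n : ℕ} (f : F n) {ts us : Fin n → Term F} :
      (∀ i, EqE E (ts i) (us i)) → EqE E (.app n f ts) (.app n f us)

/-- A theory is non-trivial if distinct variables are not equated. -/
def NonTrivial (E : Set (Term F × Term F)) : Prop :=
  ∀ x y : ℕ, x ≠ y → ¬ EqE E (.var x) (.var y)

/-- A theory is regular if both sides of each identity have the same variables. -/
def Regular (E : Set (Term F × Term F)) : Prop :=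
  ∀ p ∈ E, (Prod.fst p).vars = (Prod.snd p).vars

/-- A substitution: a map `V → T(Σ,V)` with finite domain. -/
structure Subst (F : ℕ → Type) where
  toFun : ℕ → Term F
  finite_dom : {x : ℕ | toFun x ≠ Term.var x}.Finite

/-- The domain of a substitution. -/
def Subst.Dom (σ : Subst F) : Set ℕ := {x : ℕ | σ.toFun x ≠ Term.var x}

/-- The variable range of a substitution: all variables occurring in the images
of domain variables. -/
def Subst.VRan (σ : Subst F) : Set ℕ := ⋃ x ∈ σ.Dom, (σ.toFun x).vars

/-- The instantiation preorder `σ ≤_E^X θ`: some substitution `λ` satisfies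
`λ(σ(x)) ≈_E θ(x)` for all `x ∈ X`. -/
def InstLE (E : Set (Term F × Term F)) (X : Set ℕ) (σ θ : Subst F) : Prop :=
  ∃ lam : Subst F, ∀ x ∈ X, EqE E ((σ.toFun x).subst lam.toFun) (θ.toFun x)

/-- The equivalence `σ ∼_E^X θ` induced by the instantiation preorder. -/
def InstEquiv (E : Set (Term F × Term F)) (X : Set ℕ) (σ θ : Subst F) : Prop :=
  InstLE E X σ θ ∧ InstLE E X θ σ

/-- The strict instantiation order `σ <_E^X θ`. -/
def InstLT (E : Set (Term F × Term F)) (X : Set ℕ) (σ θ : Subst F) : Prop :=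
  InstLE E X σ θ ∧ ¬ InstLE E X θ σ

/-- The set of variables occurring in a unification problem. -/
def VarsP (Γ : Set (Term F × Term F)) : Set ℕ :=
  ⋃ p ∈ Γ, (Prod.fst p).vars ∪ (Prod.snd p).vars

/-- `σ` is an `E`-unifier of the unification problem `Γ`. -/
def Unifier (E Γ : Set (Term F × Term F)) (σ : Subst F) : Prop :=
  ∀ p ∈ Γ, EqE E ((Prod.fst p).subst σ.toFun) ((Prod.snd p).subst σ.toFun)

/-- A unification problem is solvable if it has a unifier. -/
def Solvable (E Γ : Set (Term F × Term F)) : Prop := ∃ σ : Subst F, Unifier E Γ σ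

/-- `S` is a complete set of `E`-unifiers of `Γ` w.r.t. `≤_E^X`. -/
def CompleteSet (E Γ : Set (Term F × Term F)) (X : Set ℕ) (S : Set (Subst F)) : Prop :=
  (∀ σ ∈ S, Unifier E Γ σ) ∧ ∀ θ : Subst F, Unifier E Γ θ → ∃ σ ∈ S, InstLE E X σ θ

/-- `S` is a minimal complete set of `E`-unifiers of `Γ` w.r.t. `≤_E^X`:
complete, and no two distinct elements are comparable. -/
def MinimalComplete (E Γ : Set (Term F × Term F)) (X : Set ℕ) (S : Set (Subst F)) : Prop :=
  CompleteSet E Γ X S ∧ ∀ σ ∈ S, ∀ θ ∈ S, σ ≠ θ → ¬ InstLE E X σ θ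

/-- `Γ` has unification type unitary w.r.t. `≤_E^X`. -/
def TypeUnitary (E Γ : Set (Term F × Term F)) (X : Set ℕ) : Prop :=
  ∃ σ : Subst F, MinimalComplete E Γ X {σ}

/-- `Γ` has unification type finitary w.r.t. `≤_E^X`. -/
def TypeFinitary (E Γ : Set (Term F × Term F)) (X : Set ℕ) : Prop :=
  ∃ S : Set (Subst F), MinimalComplete E Γ X S ∧ S.Finite ∧ 1 < S.ncard

/-- `Γ` has unification type infinitary w.r.t. `≤_E^X`. -/
def TypeInfinitary (E Γ : Set (Term F × Term F)) (X : Set ℕ) : Prop :=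
  ∃ S : Set (Subst F), MinimalComplete E Γ X S ∧ S.Infinite

/-- `Γ` has unification type zero w.r.t. `≤_E^X`. -/
def TypeZero (E Γ : Set (Term F × Term F)) (X : Set ℕ) : Prop :=
  ¬ ∃ S : Set (Subst F), MinimalComplete E Γ X S

/-- `σ` is a `≤_E^X`-minimal `E`-unifier of `Γ`. -/
def MinUnifier (E Γ : Set (Term F × Term F)) (X : Set ℕ) (σ : Subst F) : Prop :=
  Unifier E Γ σ ∧ ∀ θ : Subst F, Unifier E Γ θ → InstLE E X θ σ → InstLE E X σ θ

/-- The set `C_E(Γ)` of unifiers all of whose range variables occur in the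
images of at least two distinct variables. -/
def CSet (E Γ : Set (Term F × Term F)) : Set (Subst F) :=
  {σ : Subst F | Unifier E Γ σ ∧
    ∀ y ∈ σ.VRan, ∃ x x' : ℕ, x ≠ x' ∧ y ∈ (σ.toFun x).vars ∩ (σ.toFun x').vars}

/-- `E` is Noetherian w.r.t. the unrestricted instantiation preorder: there is
no infinite strictly descending chain `σ₁ >_E^V σ₂ >_E^V ⋯`. -/
def Noetherian (E : Set (Term F × Term F)) : Prop :=
  ¬ ∃ f : ℕ → Subst F, ∀ n : ℕ, InstLT E Set.univ (f (n + 1)) (f n)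

theorem Term.mem_vars_subst {σ : ℕ → Term F} {y : ℕ} (t : Term F) :
    y ∈ (t.subst σ).vars ↔ ∃ x ∈ t.vars, y ∈ (σ x).vars := by
  induction t with
  | var x => simp [Term.subst, Term.vars]
  | app n f ts ih =>
    simp only [Term.subst, Term.vars, Set.mem_iUnion, ih]
    constructor
    · rintro ⟨i, x, hx, hy⟩
      exact ⟨x, ⟨i, hx⟩, hy⟩
    · rintro ⟨x, ⟨i, hx⟩, hy⟩
      exact ⟨i, x, hx, hy⟩

theorem Term.subst_subst (σ τ : ℕ → Term F) (t : Term F) :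
    (t.subst σ).subst τ = t.subst (fun x => (σ x).subst τ) := by
  induction t with
  | var x => rfl
  | app n f ts ih => simp only [Term.subst, ih]

theorem Term.subst_congr {σ τ : ℕ → Term F} {t : Term F}
    (h : ∀ x ∈ t.vars, σ x = τ x) : t.subst σ = t.subst τ := by
  induction t with
  | var x => exact h x rfl
  | app n f ts ih =>
    simp only [Term.subst]
    congr 1
    funext i
    exact ih i fun x hx => h x (Set.mem_iUnion.2 ⟨i, hx⟩)

theorem Term.subst_var (t : Term F) : t.subst .var = t := by
  induction t with
  | var x => rfl
  | app n f ts ih => simp only [Term.subst, ih]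

theorem Term.finite_vars (t : Term F) : t.vars.Finite := by
  induction t with
  | var x => exact Set.finite_singleton x
  | app n f ts ih => exact Set.finite_iUnion ih

theorem EqE.subst {E : Set (Term F × Term F)} {s t : Term F} (h : EqE E s t)
    (τ : ℕ → Term F) : EqE E (s.subst τ) (t.subst τ) := by
  induction h with
  | ax σ h =>
    rw [Term.subst_subst, Term.subst_subst]
    exact .ax _ h
  | refl t => exact .refl _
  | symm _ ih => exact ih.symm
  | trans _ _ ih₁ ih₂ => exact ih₁.trans ih₂
  | congr f _ ih => exact .congr f ih

theorem EqE.vars_eq {E : Set (Term F × Term F)} (hreg : Regular E) {s t : Term F}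
    (h : EqE E s t) : s.vars = t.vars := by
  induction h with
  | @ax s t σ h =>
    have hst : s.vars = t.vars := hreg _ h
    ext y
    rw [Term.mem_vars_subst, Term.mem_vars_subst, hst]
  | refl t => rfl
  | symm _ ih => exact ih.symm
  | trans _ _ ih₁ ih₂ => exact ih₁.trans ih₂
  | congr f _ ih => simp only [Term.vars, ih]

/-- The renaming of variables by `π`. -/
def permSubst (F : ℕ → Type) (π : Equiv.Perm ℕ) : ℕ → Term F := fun x => .var (π x)

theorem Term.mem_vars_rename {π : Equiv.Perm ℕ} {y : ℕ} {t : Term F} :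
    y ∈ (t.subst (permSubst F π)).vars ↔ ∃ z ∈ t.vars, π z = y := by
  simp [Term.mem_vars_subst, permSubst, Term.vars, eq_comm]

/-- A finite set closed under `θ` and containing its domain. -/
theorem Subst.exists_support (θ : Subst F) :
    ∃ W : Finset ℕ, (∀ x ∉ W, θ.toFun x = .var x) ∧
      ∀ x ∈ W, ∀ y ∈ (θ.toFun x).vars, y ∈ W := by
  have hfin : (θ.Dom ∪ θ.VRan).Finite :=
    θ.finite_dom.union (θ.finite_dom.biUnion fun x _ => (θ.toFun x).finite_vars)
  refine ⟨hfin.toFinset, fun x hx => ?_, fun x hx y hy => ?_⟩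
  · by_contra hne
    exact hx (hfin.mem_toFinset.2 (Or.inl hne))
  · by_cases hdom : x ∈ θ.Dom
    · exact hfin.mem_toFinset.2 (Or.inr (Set.mem_biUnion hdom hy))
    · rw [not_not.1 hdom] at hy
      obtain rfl : y = x := hy
      exact hx

/-- `π` permutes `W` and sends no variable occurring in `θ x` with `x ∉ B` into `B`, so that after
renaming by `π` the variables of `B ⊆ W` are free to be mapped to themselves. -/
structure Freeing (θ : Subst F) (W B : Finset ℕ) (π : Equiv.Perm ℕ) : Prop where
  subset : B ⊆ W
  fixes : ∀ x ∉ W, π x = x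
  avoids : ∀ x ∉ B, ∀ y ∈ (θ.toFun x).vars, π y ∉ B

theorem Freeing.insert {θ : Subst F} {W B : Finset ℕ} {π : Equiv.Perm ℕ}
    (h : Freeing θ W B π) {x y : ℕ} (hx : x ∉ B) (hxW : x ∈ W) (hyW : y ∈ W)
    (hy : y ∈ (θ.toFun x).vars)
    (honly : ∀ x' ∉ B, x' ≠ x → y ∉ (θ.toFun x').vars) :
    Freeing θ W (insert x B) (Equiv.swap (π y) x * π) := by
  have hπyW : π y ∈ W := by
    by_contra hn
    exact hn ((π.injective (h.fixes _ hn)).symm ▸ hyW)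
  refine ⟨Finset.insert_subset hxW h.subset, fun w hw => ?_, fun x' hx' z hz => ?_⟩
  · rw [Equiv.Perm.mul_apply, h.fixes w hw]
    exact Equiv.swap_apply_of_ne_of_ne (fun e => hw (e ▸ hπyW)) (fun e => hw (e ▸ hxW))
  · simp only [Finset.mem_insert, not_or] at hx' ⊢
    have hzy : π z ≠ π y := fun e =>
      honly x' hx'.2 hx'.1 (π.injective e ▸ hz)
    rw [Equiv.Perm.mul_apply]
    by_cases hzx : π z = x
    · rw [hzx, Equiv.swap_apply_right]
      exact ⟨fun e => hzy (hzx.trans e.symm), h.avoids x hx y hy⟩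
    · rw [Equiv.swap_apply_of_ne_of_ne hzy hzx]
      exact ⟨hzx, h.avoids x' hx'.2 z hz⟩

/-- The set `B` may be chosen disjoint from `X` and so large that every variable in the image of a
variable outside `B` occurs in the image of another one. -/
theorem Subst.exists_freeing (θ : Subst F) {W : Finset ℕ}
    (hW : ∀ x ∈ W, ∀ y ∈ (θ.toFun x).vars, y ∈ W) (X : Set ℕ)
    (hX : ∀ x ∈ X, ∀ y ∈ (θ.toFun x).vars, ∃ x' ∈ X, x' ≠ x ∧ y ∈ (θ.toFun x').vars) :
    ∃ B π, Freeing θ W B π ∧ (∀ x ∈ X, x ∉ B) ∧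
      ∀ x ∈ W, x ∉ B → ∀ y ∈ (θ.toFun x).vars,
        ∃ x' ∉ B, x' ≠ x ∧ y ∈ (θ.toFun x').vars := by
  have hfin : {B : Finset ℕ | (∃ π, Freeing θ W B π) ∧ ∀ x ∈ X, x ∉ B}.Finite :=
    (Finset.finite_toSet W.powerset).subset fun B hB =>
      Finset.mem_powerset.2 hB.1.choose_spec.subset
  obtain ⟨B, ⟨⟨π, hπ⟩, hBX⟩, hmax⟩ := hfin.exists_maximal
    ⟨∅, ⟨1, Finset.empty_subset W, fun _ _ => rfl, fun _ _ _ _ => Finset.notMem_empty _⟩,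
      fun _ _ => Finset.notMem_empty _⟩
  refine ⟨B, π, hπ, hBX, fun x hxW hxB y hy => ?_⟩
  by_contra! honly
  refine hxB (hmax ⟨⟨_, hπ.insert hxB hxW (hW x hxW y hy) hy honly⟩, fun z hz hzB => ?_⟩
    (Finset.subset_insert x B) (Finset.mem_insert_self x B))
  rcases Finset.mem_insert.1 hzB with rfl | hzB
  · obtain ⟨x', hx', hne, hyx'⟩ := hX z hz y hy
    exact honly x' (hBX x' hx') hne hyx'
  · exact hBX z hz hzB

open Classical in
/-- The identity on `B`, and `θ` renamed by `π` elsewhere. -/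
noncomputable def Freeing.subst {θ : Subst F} {W B : Finset ℕ} {π : Equiv.Perm ℕ}
    (h : Freeing θ W B π) (hθ : ∀ x ∉ W, θ.toFun x = .var x) : Subst F where
  toFun x := if x ∈ B then .var x else (θ.toFun x).subst (permSubst F π)
  finite_dom := W.finite_toSet.subset fun x hx => by
    by_contra hxW
    have hxB : x ∉ B := fun hB => hxW (h.subset hB)
    simp [hxB, hθ x hxW, Term.subst, permSubst, h.fixes x hxW] at hx

open Classical in
theorem Freeing.instLE {θ : Subst F} {W B : Finset ℕ} {π : Equiv.Perm ℕ}
    (h : Freeing θ W B π) (hθ : ∀ x ∉ W, θ.toFun x = .var x) (E : Set (Term F × Term F)) :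
    InstLE E Set.univ (h.subst hθ) θ := by
  refine ⟨⟨fun x => if x ∈ B then θ.toFun x else .var (π.symm x),
    W.finite_toSet.subset fun x hx => ?_⟩, fun x _ => ?_⟩
  · by_contra hxW
    have hxB : x ∉ B := fun hB => hxW (h.subset hB)
    have hπx : π.symm x = x := π.symm_apply_eq.2 (h.fixes x hxW).symm
    simp [hxB, hπx] at hx
  · by_cases hxB : x ∈ B
    · simpa [Freeing.subst, hxB, Term.subst] using EqE.refl (θ.toFun x)
    · simp only [Freeing.subst, hxB, if_false]
      rw [Term.subst_subst, Term.subst_congr (τ := .var), Term.subst_var]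
      · exact .refl _
      · intro y hy
        simp [permSubst, Term.subst, h.avoids x hxB y hy]

/-- Lemma `lem:uset`: for a non-trivial regular theory `E`
and a unification problem `Γ = {s ≈ t}` with `Var(s) ∩ Var(t) = ∅`, the set
`C_E(Γ)` is a complete set of `E`-unifiers of `Γ` w.r.t. `≤_E^V`. -/
theorem stmt4 {F : ℕ → Type} (E : Set (Term F × Term F)) (hE : NonTrivial E)
    (hreg : Regular E) (s t : Term F) (hd : s.vars ∩ t.vars = ∅) :
    CompleteSet E {(s, t)} Set.univ (CSet E {(s, t)}) := by
  refine ⟨fun σ hσ => hσ.1, fun θ hθ => ?_⟩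
  have heq : EqE E (s.subst θ.toFun) (t.subst θ.toFun) := hθ (s, t) rfl
  have hdisj : ∀ x ∈ s.vars, x ∉ t.vars := fun x hs ht =>
    Set.notMem_empty x (hd ▸ ⟨hs, ht⟩)
  obtain ⟨W, hθW, hW⟩ := θ.exists_support
  obtain ⟨B, π, hB, hBX, hshared⟩ := θ.exists_freeing hW (s.vars ∪ t.vars) <| by
    rintro x (hx | hx) y hy
    · have hys := (Term.mem_vars_subst s).2 ⟨x, hx, hy⟩
      rw [heq.vars_eq hreg, Term.mem_vars_subst] at hys
      obtain ⟨x', hx', hy'⟩ := hys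
      exact ⟨x', Or.inr hx', fun e => hdisj x hx (e ▸ hx'), hy'⟩
    · have hyt := (Term.mem_vars_subst t).2 ⟨x, hx, hy⟩
      rw [← heq.vars_eq hreg, Term.mem_vars_subst] at hyt
      obtain ⟨x', hx', hy'⟩ := hyt
      exact ⟨x', Or.inl hx', fun e => hdisj x' hx' (e ▸ hx), hy'⟩
  have hout : ∀ x ∉ B, (hB.subst hθW).toFun x = (θ.toFun x).subst (permSubst F π) :=
    fun x hx => if_neg hx
  refine ⟨hB.subst hθW, ⟨?_, fun y hy => ?_⟩, hB.instLE hθW E⟩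
  · rintro _ rfl
    have hrename : ∀ u : Term F, u.vars ⊆ s.vars ∪ t.vars →
        u.subst (hB.subst hθW).toFun = (u.subst θ.toFun).subst (permSubst F π) := fun u hu => by
      rw [Term.subst_subst]
      exact Term.subst_congr fun x hx => hout x (hBX x (hu hx))
    simp only [hrename s Set.subset_union_left, hrename t Set.subset_union_right]
    exact heq.subst _
  · obtain ⟨x, hx, hy⟩ := Set.mem_iUnion₂.1 hy
    have hxB : x ∉ B := fun hxB => hx (if_pos hxB)
    have hxW : x ∈ W := by
      by_contra hxW
      apply hx
      simp [hout x hxB, hθW x hxW, Term.subst, permSubst, hB.fixes x hxW]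
    rw [hout x hxB] at hy
    obtain ⟨z, hz, rfl⟩ := Term.mem_vars_rename.1 hy
    obtain ⟨x', hx'B, hne, hz'⟩ := hshared x hxW hxB z hz
    refine ⟨x, x', hne.symm, ?_, ?_⟩
    · rwa [hout x hxB]
    · rw [hout x' hx'B]
      exact Term.mem_vars_rename.2 ⟨z, hz', rfl⟩

end UnifFW
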